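/- arXiv:2603.28101 — 3 statements merged into one kernel-verified Lean document; each statement's English description precedes it below -/
import Mathlib

section
/- Let n and m be positive integers with m ≤ n, let L : Fin n → ℝ be antitone (i.e., i ≤ j implies L j ≤ L i, so lengths are listed in descending order), let F : ℕ → ℝ be a monotone nonnegative function, and let T ≥ 0. For a partition of Fin n into exactly m nonempty blocks, define its makespan as the maximum over the blocks g of F(card g) · (max of L over g) · T. Then there exists a partition of Fin n into exactly m nonempty blocks, each of which is a contiguous interval of indices {a, a+1, …, b}, whose makespan is less than or equal to the makespan of every partition of Fin n into exactly m nonempty blocks. -/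
open Finset

/-- Cost of a single block `g`: interference factor `F (card g)` times the maximum
trajectory length in `g`, times the base per-token time `T`. -/
noncomputable def blockCost {n : ℕ} (L : Fin n → ℝ) (F : ℕ → ℝ) (T : ℝ)
    (g : Finset (Fin n)) : ℝ :=
  if h : g.Nonempty then F g.card * g.sup' h L * T else 0

/-- Makespan of a partition: the maximum block cost over its parts. -/
noncomputable def makespan {n : ℕ} (L : Fin n → ℝ) (F : ℕ → ℝ) (T : ℝ)
    (P : Finpartition (univ : Finset (Fin n))) : ℝ :=
  if h : P.parts.Nonempty then P.parts.sup' h (blockCost L F T) else 0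

/-- A partition is contiguous if every block is an interval `{a, a+1, …, b}` of indices. -/
def Contiguous {n : ℕ} (P : Finpartition (univ : Finset (Fin n))) : Prop :=
  ∀ g ∈ P.parts, ∃ a b : Fin n, a ≤ b ∧ g = Finset.Icc a b

/-- The partition obtained by relabelling the elements of the ground set along a permutation. -/
def Finpartition.relabel {α : Type*} [Fintype α] [DecidableEq α] (e : Equiv.Perm α)
    (P : Finpartition (univ : Finset α)) : Finpartition (univ : Finset α) :=
  (P.map (e.finsetCongr.toOrderIso (fun _ _ h => Finset.map_subset_map.2 h)
    (fun _ _ h => Finset.map_subset_map.2 h))).copy (Finset.map_univ_equiv e)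

lemma Finpartition.parts_relabel {α : Type*} [Fintype α] [DecidableEq α]
    (e : Equiv.Perm α) (P : Finpartition (univ : Finset α)) :
    (P.relabel e).parts = P.parts.map e.finsetCongr.toEmbedding :=
  rfl

lemma Finpartition.mem_parts_relabel {α : Type*} [Fintype α] [DecidableEq α]
    {e : Equiv.Perm α} {P : Finpartition (univ : Finset α)} {s : Finset α} :
    s ∈ (P.relabel e).parts ↔ ∃ g ∈ P.parts, g.map e.toEmbedding = s := by
  rw [Finpartition.parts_relabel, mem_map]
  rfl

lemma Finpartition.card_parts_relabel {α : Type*} [Fintype α] [DecidableEq α]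
    (e : Equiv.Perm α) (P : Finpartition (univ : Finset α)) :
    (P.relabel e).parts.card = P.parts.card := by
  simp [Finpartition.parts_relabel]

/-- The least element of the block containing `x`. -/
def Finpartition.leastOfPart {n : ℕ} (P : Finpartition (univ : Finset (Fin n))) (x : Fin n) :
    Fin n :=
  (P.part x).min' (P.part_nonempty.2 (mem_univ x))

section leastOfPart

variable {n : ℕ} {P : Finpartition (univ : Finset (Fin n))} {x : Fin n}

lemma Finpartition.leastOfPart_mem_part (P : Finpartition (univ : Finset (Fin n))) (x : Fin n) :
    P.leastOfPart x ∈ P.part x :=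
  min'_mem _ _

lemma Finpartition.leastOfPart_le (P : Finpartition (univ : Finset (Fin n))) (x : Fin n) :
    P.leastOfPart x ≤ x :=
  min'_le _ _ (P.mem_part (mem_univ x))

lemma Finpartition.leastOfPart_mem {g : Finset (Fin n)} (hg : g ∈ P.parts) (hx : x ∈ g) :
    P.leastOfPart x ∈ g := by
  simpa [P.part_eq_of_mem hg hx] using P.leastOfPart_mem_part x

lemma Finpartition.leastOfPart_eq_iff {g : Finset (Fin n)} (hg : g ∈ P.parts) (hx : x ∈ g)
    {y : Fin n} : P.leastOfPart y = P.leastOfPart x ↔ y ∈ g := by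
  refine ⟨fun h => ?_, fun hy => ?_⟩
  · have h₁ := P.leastOfPart_mem_part y
    rw [h] at h₁
    rw [← P.eq_of_mem_parts (P.part_mem.2 (mem_univ y)) hg h₁ (leastOfPart_mem hg hx)]
    exact P.mem_part (mem_univ y)
  · simp only [leastOfPart, P.part_eq_of_mem hg hx, P.part_eq_of_mem hg hy]

end leastOfPart

/-- If `f ∘ σ` is monotone and `f` is bounded above by the identity, then `f ∘ σ` is too. -/
lemma Fin.apply_perm_le_of_monotone {n : ℕ} {f : Fin n → Fin n} (hf : ∀ x, f x ≤ x)
    (σ : Equiv.Perm (Fin n)) (hσ : Monotone (f ∘ σ)) (t : Fin n) : f (σ t) ≤ t := by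
  have hsub : (Iio (f (σ t))).map σ.symm.toEmbedding ⊆ Iio t := by
    intro y hy
    obtain ⟨x, hx, rfl⟩ := mem_map.1 hy
    rw [mem_Iio] at hx ⊢
    by_contra! h
    have h₁ : f (σ t) ≤ f x := by simpa using hσ h
    exact absurd (h₁.trans (hf x)) (not_le.2 hx)
  simpa using card_le_card hsub

/-- A nonempty order-connected finset of a linear order is a closed interval. -/
lemma Finset.exists_eq_Icc_of_ordConnected {α : Type*} [LinearOrder α] [LocallyFiniteOrder α]
    {s : Finset α} (hs : s.Nonempty) (hc : (s : Set α).OrdConnected) :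
    ∃ a b, a ≤ b ∧ s = Icc a b := by
  refine ⟨s.min' hs, s.max' hs, min'_le _ _ (max'_mem _ _), subset_antisymm
    (fun x hx => mem_Icc.2 ⟨min'_le _ _ hx, le_max' _ _ hx⟩) fun x hx => ?_⟩
  exact hc.out (min'_mem s hs) (max'_mem s hs) (mem_Icc.1 hx)

lemma makespan_le_of_forall_exists {n : ℕ} {L : Fin n → ℝ} {F : ℕ → ℝ} {T : ℝ}
    {P Q : Finpartition (univ : Finset (Fin n))} (hQ : Q.parts.Nonempty)
    (h : ∀ s ∈ Q.parts, ∃ g ∈ P.parts, blockCost L F T s ≤ blockCost L F T g) :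
    makespan L F T Q ≤ makespan L F T P := by
  obtain ⟨s, hs⟩ := hQ
  obtain ⟨g, hg, -⟩ := h s hs
  rw [makespan, makespan, dif_pos ⟨s, hs⟩, dif_pos ⟨g, hg⟩]
  refine sup'_le _ _ fun s hs => ?_
  obtain ⟨g, hg, hle⟩ := h s hs
  exact hle.trans (le_sup' _ hg)

lemma blockCost_le_of_forall_le {n : ℕ} {L : Fin n → ℝ} (hL : Antitone L) {F : ℕ → ℝ}
    (hF : ∀ k, 0 ≤ F k) {T : ℝ} (hT : 0 ≤ T) {s g : Finset (Fin n)} (hcard : s.card = g.card)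
    {a : Fin n} (ha : a ∈ g) (hs : ∀ t ∈ s, a ≤ t) :
    blockCost L F T s ≤ blockCost L F T g := by
  have hg : g.Nonempty := ⟨a, ha⟩
  have hs' : s.Nonempty := by rw [← card_pos, hcard, card_pos]; exact hg
  rw [blockCost, blockCost, dif_pos hs', dif_pos hg, hcard]
  have hsup : s.sup' hs' L ≤ g.sup' hg L :=
    sup'_le _ _ fun t ht => (hL (hs t ht)).trans (le_sup' L ha)
  have := hF g.card
  gcongr

/-- Reordering the elements by the least element of their block makes a partition contiguous
without increasing its makespan. -/
lemma exists_contiguous_makespan_le {n : ℕ} {L : Fin n → ℝ} (hL : Antitone L) {F : ℕ → ℝ}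
    (hF : ∀ k, 0 ≤ F k) {T : ℝ} (hT : 0 ≤ T) (P : Finpartition (univ : Finset (Fin n)))
    (hP : P.parts.Nonempty) :
    ∃ Q : Finpartition (univ : Finset (Fin n)), Q.parts.card = P.parts.card ∧ Contiguous Q ∧
      makespan L F T Q ≤ makespan L F T P := by
  set σ := Tuple.sort P.leastOfPart
  have hσ : Monotone (P.leastOfPart ∘ σ) := Tuple.monotone_sort _
  have hcard := P.card_parts_relabel σ.symm
  refine ⟨P.relabel σ.symm, hcard, fun s hs => ?_, makespan_le_of_forall_exists
    (by rwa [← card_pos, hcard, card_pos]) fun s hs => ?_⟩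
  · have hne := (P.relabel σ.symm).nonempty_of_mem_parts hs
    obtain ⟨g, hg, rfl⟩ := Finpartition.mem_parts_relabel.1 hs
    obtain ⟨x, hx⟩ := P.nonempty_of_mem_parts hg
    refine Finset.exists_eq_Icc_of_ordConnected hne ?_
    have hpre : ((g.map σ.symm.toEmbedding : Finset (Fin n)) : Set (Fin n)) =
        (P.leastOfPart ∘ σ) ⁻¹' {P.leastOfPart x} := by
      ext y
      simp [Finpartition.leastOfPart_eq_iff hg hx]
    rw [hpre]
    exact Set.ordConnected_singleton.preimage_mono hσ
  · obtain ⟨g, hg, rfl⟩ := Finpartition.mem_parts_relabel.1 hs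
    obtain ⟨x, hx⟩ := P.nonempty_of_mem_parts hg
    refine ⟨g, hg, blockCost_le_of_forall_le hL hF hT (card_map _)
      (Finpartition.leastOfPart_mem hg hx) fun t ht => ?_⟩
    have hmem : σ t ∈ g := by simpa [Equiv.symm_apply_eq] using ht
    rw [← (Finpartition.leastOfPart_eq_iff hg hx).2 hmem]
    exact Fin.apply_perm_le_of_monotone P.leastOfPart_le σ hσ t

/-- Lemma 1: there is a contiguous partition into `m` nonempty blocks whose makespan is
at most the makespan of every partition into `m` nonempty blocks. -/
theorem exists_contiguous_optimal_partition
    (n m : ℕ) (hn : 0 < n) (hm : 0 < m) (hmn : m ≤ n)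
    (L : Fin n → ℝ) (hL : Antitone L)
    (F : ℕ → ℝ) (hFmono : Monotone F) (hFnonneg : ∀ k, 0 ≤ F k)
    (T : ℝ) (hT : 0 ≤ T) :
    ∃ Q : Finpartition (univ : Finset (Fin n)),
      Q.parts.card = m ∧ Contiguous Q ∧
        ∀ P : Finpartition (univ : Finset (Fin n)), P.parts.card = m →
          makespan L F T Q ≤ makespan L F T P := by
  obtain ⟨P₀, -, hP₀⟩ := Finpartition.exists_equipartition_card_eq (univ : Finset (Fin n)) hm.ne'
    (by simpa using hmn)
  obtain ⟨P, hP, hmin⟩ := Set.exists_min_image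
    {P : Finpartition (univ : Finset (Fin n)) | P.parts.card = m} (makespan L F T)
    (Set.toFinite _) ⟨P₀, hP₀⟩
  obtain ⟨Q, hcard, hQ, hle⟩ := exists_contiguous_makespan_le hL hFnonneg hT P
    (card_pos.1 (hm.trans_eq hP.symm))
  exact ⟨Q, hcard.trans hP, hQ, fun P' hP' => hle.trans (hmin P' hP')⟩
end

section
/- Let ι be a type, L : ι → ℝ, and let g₁, g₂ be disjoint nonempty finite subsets of ι. Suppose τ₁ ∈ g₁ attains the maximum of L over g₁ ∪ g₂. Let a ∈ g₂ and b ∈ g₁ with b ≠ τ₁ and L b ≤ L a, and define the swapped groups g₁' = (g₁ \ {b}) ∪ {a} and g₂' = (g₂ \ {a}) ∪ {b}. Then for any nonnegative function F : ℕ → ℝ and any T ≥ 0: (i) card g₁' = card g₁ and card g₂' = card g₂; and (ii) max( F(card g₁') · (max of L over g₁') · T , F(card g₂') · (max of L over g₂') · T ) ≤ max( F(card g₁) · (max of L over g₁) · T , F(card g₂) · (max of L over g₂) · T ). -/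
open Finset

/-- The swap step in the proof of Lemma 1: exchanging an element `a ∈ g₂` with an
element `b ∈ g₁` (where `b ≠ τ₁`, `L b ≤ L a`, and `τ₁ ∈ g₁` attains the maximum of `L`
over `g₁ ∪ g₂`) preserves the cardinalities of both groups and does not increase the
two-group makespan. -/
theorem swap_step {ι : Type*} [DecidableEq ι] (L : ι → ℝ)
    (g₁ g₂ : Finset ι) (h₁ : g₁.Nonempty) (h₂ : g₂.Nonempty)
    (hdisj : Disjoint g₁ g₂)
    (τ₁ : ι) (hτ₁ : τ₁ ∈ g₁) (hmax : ∀ x ∈ g₁ ∪ g₂, L x ≤ L τ₁)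
    (a : ι) (ha : a ∈ g₂) (b : ι) (hb : b ∈ g₁) (hbτ₁ : b ≠ τ₁)
    (hLba : L b ≤ L a)
    (F : ℕ → ℝ) (hF : ∀ k, 0 ≤ F k) (T : ℝ) (hT : 0 ≤ T) :
    (insert a (g₁.erase b)).card = g₁.card ∧
    (insert b (g₂.erase a)).card = g₂.card ∧
    max (F (insert a (g₁.erase b)).card *
          (insert a (g₁.erase b)).sup' (insert_nonempty a (g₁.erase b)) L * T)
        (F (insert b (g₂.erase a)).card *
          (insert b (g₂.erase a)).sup' (insert_nonempty b (g₂.erase a)) L * T)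
      ≤ max (F g₁.card * g₁.sup' h₁ L * T)
            (F g₂.card * g₂.sup' h₂ L * T) := by
  have hcard₁ : (insert a (g₁.erase b)).card = g₁.card := by
    have ha₁ : a ∉ g₁.erase b := fun h => disjoint_left.mp hdisj (mem_of_mem_erase h) ha
    rw [card_insert_of_notMem ha₁, card_erase_add_one hb]
  have hcard₂ : (insert b (g₂.erase a)).card = g₂.card := by
    have hb₂ : b ∉ g₂.erase a := fun h => disjoint_left.mp hdisj hb (mem_of_mem_erase h)
    rw [card_insert_of_notMem hb₂, card_erase_add_one ha]
  have hsup₁ : (insert a (g₁.erase b)).sup' (insert_nonempty a (g₁.erase b)) L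
      ≤ g₁.sup' h₁ L := by
    refine sup'_le _ _ fun x hx => (hmax x ?_).trans (le_sup' L hτ₁)
    rcases mem_insert.mp hx with rfl | hx
    · exact mem_union_right _ ha
    · exact mem_union_left _ (mem_of_mem_erase hx)
  have hsup₂ : (insert b (g₂.erase a)).sup' (insert_nonempty b (g₂.erase a)) L
      ≤ g₂.sup' h₂ L := by
    refine sup'_le _ _ fun x hx => ?_
    rcases mem_insert.mp hx with rfl | hx
    · exact hLba.trans (le_sup' L ha)
    · exact le_sup' L (mem_of_mem_erase hx)
  refine ⟨hcard₁, hcard₂, ?_⟩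
  rw [hcard₁, hcard₂]
  exact max_le_max
    (mul_le_mul_of_nonneg_right (mul_le_mul_of_nonneg_left hsup₁ (hF _)) hT)
    (mul_le_mul_of_nonneg_right (mul_le_mul_of_nonneg_left hsup₂ (hF _)) hT)
end

section
/- Let L : Fin n → ℝ be antitone, F : ℕ → ℝ, and T ≥ 0. For 1 ≤ j ≤ i ≤ n define OPT(i, j) as the minimum over all compositions (k₁, …, k_j) of i into j positive parts of max_{t=1..j} F(k_t) · L(s_t) · T, where s_t = k₁ + ⋯ + k_{t−1} is the (0-indexed) first position of the t-th contiguous block. Then OPT satisfies the Bellman recurrence: OPT(i, 1) = L(0) · T · F(i) for all 1 ≤ i ≤ n, and for j ≥ 2, OPT(i, j) = min over k with j−1 ≤ k ≤ i−1 of max( OPT(k, j−1), L(k) · T · F(i − k) ). -/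
open Finset

/-- `OPT L F T i j` is the minimum, over all compositions `(k 0, …, k (j-1))` of `i`
into `j` positive parts, of the maximum over `t` of `F (k t) * L (s t) * T`, where
`s t = k 0 + ⋯ + k (t-1)` is the 0-indexed first position of the `t`-th contiguous
block. -/
noncomputable def OPT {n : ℕ} (L : Fin n → ℝ) (F : ℕ → ℝ) (T : ℝ) (i j : ℕ) : ℝ :=
  sInf {x : ℝ | ∃ k : Fin j → ℕ, (∀ t, 0 < k t) ∧ (∑ t, k t = i) ∧
    ∃ hs : ∀ t : Fin j, (∑ u ∈ Finset.Iio t, k u) < n,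
      x = ⨆ t : Fin j, F (k t) * L ⟨∑ u ∈ Finset.Iio t, k u, hs t⟩ * T}

/-- The set of makespans of partitions of the first `i` trajectories into `j` blocks. -/
def makespans {n : ℕ} (L : Fin n → ℝ) (F : ℕ → ℝ) (T : ℝ) (i j : ℕ) : Set ℝ :=
  {x : ℝ | ∃ k : Fin j → ℕ, (∀ t, 0 < k t) ∧ (∑ t, k t = i) ∧
    ∃ hs : ∀ t : Fin j, (∑ u ∈ Finset.Iio t, k u) < n,
      x = ⨆ t : Fin j, F (k t) * L ⟨∑ u ∈ Finset.Iio t, k u, hs t⟩ * T}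

theorem makespans_finite {n : ℕ} (L : Fin n → ℝ) (F : ℕ → ℝ) (T : ℝ) (i j : ℕ) :
    (makespans L F T i j).Finite := by
  classical
  refine ((Set.finite_Icc (0 : Fin j → ℕ) (fun _ => i)).image (fun k =>
    if hs : ∀ t : Fin j, (∑ u ∈ Finset.Iio t, k u) < n then
      ⨆ t : Fin j, F (k t) * L ⟨∑ u ∈ Finset.Iio t, k u, hs t⟩ * T else 0)).subset ?_
  rintro x ⟨k, -, hsum, hs, rfl⟩
  refine ⟨k, ⟨fun t => Nat.zero_le _, fun t => ?_⟩, dif_pos hs⟩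
  rw [← hsum]
  exact Finset.single_le_sum (f := k) (fun _ _ => Nat.zero_le _) (Finset.mem_univ t)

theorem makespans_one {n : ℕ} (L : Fin n → ℝ) (F : ℕ → ℝ) (T : ℝ) {i : ℕ}
    (hi : 1 ≤ i) (hn : 0 < n) : makespans L F T i 1 = {L ⟨0, hn⟩ * T * F i} := by
  have hIio : ∀ t : Fin 1, Finset.Iio t = ∅ := by decide
  ext x
  constructor
  · rintro ⟨k, -, hsum, hs, rfl⟩
    obtain rfl : k 0 = i := by simpa using hsum
    simp [hIio, ciSup_unique]
    ring
  · rintro rfl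
    refine ⟨fun _ => i, fun _ => hi, by simp, fun t => by simpa [hIio] using hn, ?_⟩
    simp [hIio, ciSup_unique]
    ring

theorem ciSup_fin_succ_last {m : ℕ} (f : Fin (m + 2) → ℝ) :
    ⨆ t, f t = max (⨆ t : Fin (m + 1), f t.castSucc) (f (Fin.last (m + 1))) := by
  apply le_antisymm
  · refine ciSup_le fun t => ?_
    induction t using Fin.lastCases with
    | last => exact le_max_right _ _
    | cast t =>
      exact le_max_of_le_left
        (le_ciSup (f := fun t : Fin (m + 1) => f t.castSucc) (Set.finite_range _).bddAbove t)
  · exact max_le (ciSup_le fun t => le_ciSup (Set.finite_range f).bddAbove _)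
      (le_ciSup (Set.finite_range f).bddAbove _)

theorem sum_Iio_castSucc {m : ℕ} (k : Fin (m + 1) → ℕ) (t : Fin m) :
    ∑ u ∈ Finset.Iio t.castSucc, k u = ∑ u ∈ Finset.Iio t, k u.castSucc := by
  rw [← Fin.map_castSuccEmb_Iio, Finset.sum_map]
  rfl

theorem sum_Iio_last {m : ℕ} (k : Fin (m + 1) → ℕ) :
    ∑ u ∈ Finset.Iio (Fin.last m), k u = ∑ u : Fin m, k u.castSucc := by
  rw [Fin.Iio_last_eq_map, Finset.sum_map]
  rfl

/-- Splitting off the last block of a partition. -/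
theorem mem_makespans_succ {n : ℕ} (L : Fin n → ℝ) (F : ℕ → ℝ) (T : ℝ) {i m : ℕ} {x : ℝ} :
    x ∈ makespans L F T i (m + 2) ↔
      ∃ k : ℕ, m + 1 ≤ k ∧ k < i ∧ ∃ hk : k < n, ∃ y ∈ makespans L F T k (m + 1),
        x = max y (L ⟨k, hk⟩ * T * F (i - k)) := by
  constructor
  · rintro ⟨k, hpos, hsum, hs, rfl⟩
    rw [Fin.sum_univ_castSucc] at hsum
    have hlast := hs (Fin.last (m + 1))
    rw [sum_Iio_last] at hlast
    have hl := hpos (Fin.last (m + 1))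
    refine ⟨∑ u : Fin (m + 1), k u.castSucc, ?_, by omega, hlast, _,
      ⟨fun t => k t.castSucc, fun t => hpos _, rfl,
        fun t => by simpa only [sum_Iio_castSucc] using hs t.castSucc, rfl⟩, ?_⟩
    · simpa using Finset.sum_le_sum (s := Finset.univ) (f := fun _ : Fin (m + 1) => 1)
        (g := fun t => k t.castSucc) fun t _ => hpos t.castSucc
    · rw [ciSup_fin_succ_last]
      simp only [sum_Iio_castSucc, sum_Iio_last]
      rw [← hsum, Nat.add_sub_cancel_left]
      congr 1
      ring
  · rintro ⟨p, -, hpi, hp, y, ⟨k, hpos, hsum, hs, rfl⟩, rfl⟩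
    refine ⟨Fin.snoc (α := fun _ => ℕ) k (i - p), fun t => ?_, ?_, fun t => ?_, ?_⟩
    · induction t using Fin.lastCases with
      | last => simpa using hpi
      | cast t => simpa using hpos t
    · rw [Fin.sum_univ_castSucc]
      simp only [Fin.snoc_castSucc, Fin.snoc_last, hsum]
      omega
    · induction t using Fin.lastCases with
      | last => simpa [sum_Iio_last, hsum] using hp
      | cast t => simpa [sum_Iio_castSucc] using hs t
    · rw [ciSup_fin_succ_last]
      simp only [sum_Iio_castSucc, sum_Iio_last, Fin.snoc_castSucc, Fin.snoc_last, hsum]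
      congr 1
      ring

theorem makespans_nonempty {n : ℕ} (L : Fin n → ℝ) (F : ℕ → ℝ) (T : ℝ) (m : ℕ) :
    ∀ i : ℕ, m + 1 ≤ i → i ≤ n → (makespans L F T i (m + 1)).Nonempty := by
  induction m with
  | zero =>
    intro i hi hin
    rw [zero_add, makespans_one L F T (by omega) (by omega)]
    exact Set.singleton_nonempty _
  | succ m ih =>
    intro i hi hin
    obtain ⟨y, hy⟩ := ih (m + 1) le_rfl (by omega)
    exact ⟨_, (mem_makespans_succ L F T).2
      ⟨m + 1, le_rfl, by omega, by omega, y, hy, rfl⟩⟩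

theorem isLeast_OPT {n : ℕ} (L : Fin n → ℝ) (F : ℕ → ℝ) (T : ℝ) {i m : ℕ}
    (hi : m + 1 ≤ i) (hin : i ≤ n) :
    IsLeast (makespans L F T i (m + 1)) (OPT L F T i (m + 1)) :=
  ⟨(makespans_nonempty L F T m i hi hin).csInf_mem (makespans_finite L F T i (m + 1)),
    fun _ hx => csInf_le (makespans_finite L F T i (m + 1)).bddBelow hx⟩

/-- Correctness of the Bellman recurrence of the presorted dynamic programming:
`OPT(i, 1) = L 0 * T * F i` for `1 ≤ i ≤ n`, and for `2 ≤ j ≤ i ≤ n`,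
`OPT(i, j) = min_{j-1 ≤ k ≤ i-1} max (OPT(k, j-1)) (L k * T * F (i - k))`. -/
theorem OPT_bellman {n : ℕ} (L : Fin n → ℝ) (hL : Antitone L)
    (F : ℕ → ℝ) (T : ℝ) (hT : 0 ≤ T) :
    (∀ i : ℕ, 1 ≤ i → i ≤ n → ∀ hn : 0 < n,
      OPT L F T i 1 = L ⟨0, hn⟩ * T * F i) ∧
    (∀ i j : ℕ, 2 ≤ j → j ≤ i → i ≤ n →
      OPT L F T i j =
        sInf {x : ℝ | ∃ k : ℕ, j - 1 ≤ k ∧ k ≤ i - 1 ∧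
          ∃ hk : k < n,
            x = max (OPT L F T k (j - 1)) (L ⟨k, hk⟩ * T * F (i - k))}) := by
  refine ⟨fun i hi hin hn => ?_, fun i j hj hji hin => ?_⟩
  · have h := (isLeast_OPT L F T (m := 0) hi hin).1
    rw [zero_add, makespans_one L F T hi hn] at h
    exact h
  · obtain ⟨m, rfl⟩ : ∃ m, j = m + 2 := ⟨j - 2, by omega⟩
    rw [show m + 2 - 1 = m + 1 by omega]
    have hopt := isLeast_OPT L F T (m := m + 1) hji hin
    have hmem : ∀ k, m + 1 ≤ k → k ≤ i - 1 → ∀ hk : k < n,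
        max (OPT L F T k (m + 1)) (L ⟨k, hk⟩ * T * F (i - k)) ∈ makespans L F T i (m + 2) :=
      fun k hmk hki hk => (mem_makespans_succ L F T).2
        ⟨k, hmk, by omega, hk, _, (isLeast_OPT L F T hmk hk.le).1, rfl⟩
    refine (IsLeast.csInf_eq ⟨?_, ?_⟩).symm
    · obtain ⟨k, hmk, hki, hk, y, hy, hxy⟩ := (mem_makespans_succ L F T).1 hopt.1
      refine ⟨k, hmk, by omega, hk,
        le_antisymm (hopt.2 (hmem k hmk (by omega) hk)) ?_⟩
      exact (max_le_max_right _ ((isLeast_OPT L F T hmk hk.le).2 hy)).trans_eq hxy.symm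
    · rintro x ⟨k, hmk, hki, hk, rfl⟩
      exact hopt.2 (hmem k hmk hki hk)
end
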